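/- (Lemma A.3, weak gap bound for the conditioned measure.) For every β ≥ 1 there exist C > 0 and ξ₀ > 0 such that for all 0 < ξ ≤ ξ₀, all integers N ≥ 2, all integers 1 ≤ K ≤ N^{1/2}, every boundary vector y ∈ R_K(ξ), and all s > 0, the conditional measure satisfies P^{μ_y}[y_{K+1} − x_K ≤ s K^{−1/3}] ≤ C s (K² + K N^{Cξ}). -/

import Mathlib

open MeasureTheory Real
open scoped ENNReal

/-- The semicircle density. -/
noncomputable def semicircle (E : ℝ) : ℝ :=
  if |E| ≤ 2 then Real.sqrt (4 - E ^ 2) / (2 * Real.pi) else 0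

/-- The external potential `V_y` felt by the first `K` particles given the boundary
configuration `y` (whose relevant coordinates are `y_{K+1}, …, y_N`). -/
noncomputable def Vy (N K : ℕ) (y : ℕ → ℝ) (t : ℝ) : ℝ :=
  ((N : ℝ) ^ (-(2 : ℝ) / 3) * t) ^ 2 / 2
    - (2 / (N : ℝ)) * ∑ j ∈ Finset.Icc (K + 1) N, Real.log |t - y j|

/-- The conditional Hamiltonian `H_y`. -/
noncomputable def Hy (N K : ℕ) (y : ℕ → ℝ) (x : Fin K → ℝ) : ℝ :=
  (1 / 2) * ∑ i, Vy N K y (x i)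
    - (1 / (N : ℝ)) * ∑ i : Fin K, ∑ j : Fin K, if i < j then Real.log (x j - x i) else 0

open Classical in
/-- Unnormalized density of the conditional measure `μ_y`, supported on
`{x : x_1 < ⋯ < x_K < y_{K+1}}`. -/
noncomputable def condDensity (β : ℝ) (N K : ℕ) (y : ℕ → ℝ) (x : Fin K → ℝ) : ℝ :=
  if (∀ i j : Fin K, i < j → x i < x j) ∧ ∀ i : Fin K, x i < y (K + 1) then
    Real.exp (-(β * (N : ℝ)) * Hy N K y x)
  else 0

/-- The set `{x : x_1 < ⋯ < x_K < b}` supporting the conditional measure. -/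
def orderedBelow (K : ℕ) (b : ℝ) : Set (Fin K → ℝ) :=
  {x | (∀ i j : Fin K, i < j → x i < x j) ∧ ∀ i : Fin K, x i < b}

/-- The total logarithmic interaction of an ordered configuration. -/
noncomputable def pairLog {K : ℕ} (x : Fin K → ℝ) : ℝ :=
  ∑ i : Fin K, ∑ j : Fin K, if i < j then Real.log (x j - x i) else 0

lemma measurableSet_orderedBelow (K : ℕ) (b : ℝ) : MeasurableSet (orderedBelow K b) := by
  have h : orderedBelow K b =
      (⋂ (i : Fin K) (j : Fin K) (_ : i < j), {x | x i < x j}) ∩ ⋂ i : Fin K, {x | x i < b} := by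
    ext x
    simp [orderedBelow]
  rw [h]
  refine MeasurableSet.inter ?_ ?_
  · refine MeasurableSet.iInter fun i => MeasurableSet.iInter fun j =>
      MeasurableSet.iInter fun _ => ?_
    exact measurableSet_lt (measurable_pi_apply i) (measurable_pi_apply j)
  · refine MeasurableSet.iInter fun i => ?_
    exact measurableSet_lt (measurable_pi_apply i) measurable_const

lemma measurable_condDensity (β : ℝ) (N K : ℕ) (y : ℕ → ℝ) :
    Measurable (condDensity β N K y) := by
  unfold condDensity
  refine Measurable.ite (measurableSet_orderedBelow K (y (K + 1))) ?_ measurable_const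
  unfold Hy Vy
  refine Real.measurable_exp.comp (Measurable.const_mul (Measurable.sub ?_ ?_) _)
  · refine Measurable.const_mul (Finset.measurable_sum _ fun i _ => ?_) _
    fun_prop
  · refine Measurable.const_mul (Finset.measurable_sum _ fun i _ =>
      Finset.measurable_sum _ fun j _ => ?_) _
    split_ifs <;> fun_prop

lemma condDensity_nonneg (β : ℝ) (N K : ℕ) (y : ℕ → ℝ) (x : Fin K → ℝ) :
    0 ≤ condDensity β N K y x := by
  unfold condDensity
  split_ifs <;> positivity

lemma condDensity_of_mem {β : ℝ} {N K : ℕ} (hN : 0 < N) {y : ℕ → ℝ} {x : Fin K → ℝ}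
    (hx : x ∈ orderedBelow K (y (K + 1))) :
    condDensity β N K y x =
      Real.exp (-β * (∑ i, (N : ℝ) / 2 * Vy N K y (x i) - pairLog x)) := by
  have hN' : (N : ℝ) ≠ 0 := by positivity
  unfold condDensity
  rw [if_pos (show _ ∧ _ from hx), Hy, pairLog, ← Finset.mul_sum]
  congr 1
  field_simp

lemma condDensity_of_notMem {β : ℝ} {N K : ℕ} {y : ℕ → ℝ} {x : Fin K → ℝ}
    (hx : x ∉ orderedBelow K (y (K + 1))) : condDensity β N K y x = 0 := by
  unfold condDensity
  exact if_neg hx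

lemma orderedBelow_sub_const {K : ℕ} {b t : ℝ} (ht : 0 ≤ t) {x : Fin K → ℝ}
    (hx : x ∈ orderedBelow K b) : (fun i => x i - t) ∈ orderedBelow K b :=
  ⟨fun i j h => by linarith [hx.1 i j h], fun i => by linarith [hx.2 i]⟩

lemma orderedBelow_midpoint {K : ℕ} {b c : ℝ} (hc : c ≤ b) {x : Fin K → ℝ}
    (hx : x ∈ orderedBelow K b) : (fun i => (x i + c) / 2) ∈ orderedBelow K b :=
  ⟨fun i j h => by linarith [hx.1 i j h], fun i => by linarith [hx.2 i]⟩

lemma pairLog_sub_const {K : ℕ} (x : Fin K → ℝ) (t : ℝ) :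
    pairLog (fun i => x i - t) = pairLog x := by
  simp [pairLog]

lemma pairLog_sub_le_pairLog_midpoint {K : ℕ} {b c : ℝ} {x : Fin K → ℝ}
    (hx : x ∈ orderedBelow K b) :
    pairLog x - (K : ℝ) ^ 2 ≤ pairLog (fun i => (x i + c) / 2) := by
  have hsum : (K : ℝ) ^ 2 = ∑ _i : Fin K, ∑ _j : Fin K, (1 : ℝ) := by
    simp [sq]
  rw [hsum, pairLog, pairLog, ← Finset.sum_sub_distrib]
  refine Finset.sum_le_sum fun i _ => ?_
  rw [← Finset.sum_sub_distrib]
  refine Finset.sum_le_sum fun j _ => ?_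
  split_ifs with h
  · have h1 : (x j + c) / 2 - (x i + c) / 2 = (x j - x i) / 2 := by ring
    have h2 := hx.1 i j h
    rw [h1, Real.log_div (by linarith) (by norm_num)]
    linarith [Real.log_two_lt_d9]
  · norm_num

lemma condDensity_le_of_shift_of_contraction {β : ℝ} (hβ : 1 ≤ β) {N K : ℕ} (hN : 0 < N)
    {y : ℕ → ℝ} {c : ℝ} (hc : c ≤ y (K + 1)) {ω : ℝ → ℝ} {c₀ A D u₀ t : ℝ}
    (ht : 0 < t) (hu₀ : 1 ≤ u₀)
    (hshift : ∀ x < y (K + 1), (N : ℝ) / 2 * Vy N K y (x - t) - (N : ℝ) / 2 * Vy N K y x ≤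
      t * (c₀ + 4 * ω x))
    (hcontr : ∀ x < y (K + 1), u₀ * (ω x - A) - D ≤
      (N : ℝ) / 2 * Vy N K y x - (N : ℝ) / 2 * Vy N K y ((x + c) / 2))
    {x : Fin K → ℝ} (hx : x ∈ orderedBelow K (y (K + 1))) :
    condDensity β N K y x ≤ condDensity β N K y (fun i => x i - t) +
      (β * t * K * c₀ + 4 * t / u₀ * (β * K * (u₀ * A + D) + β * K ^ 2 + K)) *
        condDensity β N K y x +
      4 * t / u₀ * (1 / 2 ^ K) * condDensity β N K y (fun i => (x i + c) / 2) := by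
  have hβ0 : 0 < β := by linarith
  have hu : 0 < u₀ := by linarith
  set W : ℝ := ∑ i, ω (x i) with hW
  set f := condDensity β N K y x with hf
  have hf0 : 0 ≤ f := condDensity_nonneg _ _ _ _ _
  have h1 : f * (1 - β * (t * (K * c₀ + 4 * W))) ≤ condDensity β N K y (fun i => x i - t) := by
    rw [condDensity_of_mem hN (orderedBelow_sub_const ht.le hx), hf, condDensity_of_mem hN hx,
      pairLog_sub_const]
    have hs : ∑ i, (N : ℝ) / 2 * Vy N K y (x i - t) - ∑ i, (N : ℝ) / 2 * Vy N K y (x i) ≤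
        t * (K * c₀ + 4 * W) := by
      rw [← Finset.sum_sub_distrib]
      refine (Finset.sum_le_sum fun i _ => hshift (x i) (hx.2 i)).trans (le_of_eq ?_)
      rw [← Finset.mul_sum, Finset.sum_add_distrib, ← Finset.mul_sum]
      simp [hW]
    have hle := mul_le_mul_of_nonneg_left hs hβ0.le
    calc _ ≤ Real.exp (-β * (∑ i, (N : ℝ) / 2 * Vy N K y (x i) - pairLog x)) *
          Real.exp (-(β * (t * (K * c₀ + 4 * W)))) := by
          gcongr
          linarith [Real.add_one_le_exp (-(β * (t * (K * c₀ + 4 * W))))]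
      _ ≤ _ := by
          rw [← Real.exp_add]
          apply Real.exp_le_exp.2
          linarith
  have h2 : f * (β * u₀ * W - (β * K * (u₀ * A + D) + β * K ^ 2 + K)) ≤
      (1 / 2 ^ K) * condDensity β N K y (fun i => (x i + c) / 2) := by
    rw [condDensity_of_mem hN (orderedBelow_midpoint hc hx), hf, condDensity_of_mem hN hx]
    have hs : u₀ * W - K * (u₀ * A + D) ≤ ∑ i, (N : ℝ) / 2 * Vy N K y (x i) -
        ∑ i, (N : ℝ) / 2 * Vy N K y ((x i + c) / 2) := by
      rw [← Finset.sum_sub_distrib]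
      refine (le_of_eq ?_).trans (Finset.sum_le_sum fun i _ => hcontr (x i) (hx.2 i))
      rw [Finset.sum_sub_distrib, ← Finset.mul_sum, Finset.sum_sub_distrib]
      simp [hW]
      ring
    have hp := pairLog_sub_le_pairLog_midpoint (c := c) hx
    have hle := mul_le_mul_of_nonneg_left hs hβ0.le
    have hle2 := mul_le_mul_of_nonneg_left hp hβ0.le
    have hexp : Real.exp (-(K : ℝ)) ≤ 1 / 2 ^ K := by
      rw [Real.exp_neg, one_div]
      gcongr
      rw [← Real.exp_one_pow]
      gcongr
      linarith [Real.exp_one_gt_d9]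
    set M := β * K * (u₀ * A + D) + β * K ^ 2 + K with hM
    calc _ ≤ Real.exp (-β * (∑ i, (N : ℝ) / 2 * Vy N K y (x i) - pairLog x)) *
          Real.exp (β * u₀ * W - M) := by
          gcongr
          linarith [Real.add_one_le_exp (β * u₀ * W - M)]
      _ ≤ Real.exp (-(K : ℝ)) * Real.exp (-β * (∑ i, (N : ℝ) / 2 * Vy N K y ((x i + c) / 2) -
          pairLog fun i => (x i + c) / 2)) := by
          rw [← Real.exp_add, ← Real.exp_add]
          apply Real.exp_le_exp.2
          rw [hM]
          linarith
      _ ≤ _ := by gcongr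
  have h3 := mul_le_mul_of_nonneg_left h2 (show 0 ≤ 4 * t / u₀ by positivity)
  have h4 : 4 * t / u₀ * (f * (β * u₀ * W - (β * K * (u₀ * A + D) + β * K ^ 2 + K))) =
      4 * t * β * W * f - 4 * t / u₀ * (β * K * (u₀ * A + D) + β * K ^ 2 + K) * f := by
    field_simp
  nlinarith

lemma lintegral_midpoint {K : ℕ} (c : ℝ) {g : (Fin K → ℝ) → ℝ≥0∞} (hg : Measurable g) :
    ∫⁻ x : Fin K → ℝ, g (fun i => (x i + c) / 2) = ENNReal.ofReal (2 ^ K) * ∫⁻ x, g x := by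
  have h1 : ∫⁻ x : Fin K → ℝ, g (fun i => (x i + c) / 2) =
      ∫⁻ x, g ((1 / 2 : ℝ) • (x - (fun _ => -c) : Fin K → ℝ)) := by
    congr 1 with x
    congr 1
    ext i
    simp
    ring
  rw [h1, lintegral_sub_right_eq_self (fun x : Fin K → ℝ => g ((1 / 2 : ℝ) • x)),
    ← lintegral_map hg (measurable_const_smul _), Measure.map_addHaar_smul _ (by norm_num),
    lintegral_smul_measure]
  congr 2
  simp

/-- If shifting a particle to the left is cheap up to an error `ω` which is controlled by
contracting the configuration towards `c`, then the top gap is rarely small. -/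
theorem condDensity_gap_le {β : ℝ} (hβ : 1 ≤ β) {N K : ℕ} (hN : 0 < N) (hK : 1 ≤ K)
    {y : ℕ → ℝ} {c : ℝ} (hc : c ≤ y (K + 1)) {ω : ℝ → ℝ} {c₀ A D u₀ t : ℝ}
    (hA : 0 ≤ A) (hD : 0 ≤ D) (hc₀ : 0 ≤ c₀)
    (ht : 0 < t) (hu₀ : 1 ≤ u₀)
    (hshift : ∀ x < y (K + 1), (N : ℝ) / 2 * Vy N K y (x - t) - (N : ℝ) / 2 * Vy N K y x ≤
      t * (c₀ + 4 * ω x))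
    (hcontr : ∀ x < y (K + 1), u₀ * (ω x - A) - D ≤
      (N : ℝ) / 2 * Vy N K y x - (N : ℝ) / 2 * Vy N K y ((x + c) / 2))
    {P : Measure (Fin K → ℝ)} [IsProbabilityMeasure P] {Z : ℝ≥0∞}
    (hP : P = Z⁻¹ • (volume.withDensity fun x => ENNReal.ofReal (condDensity β N K y x)))
    (k : Fin K) :
    P {x | y (K + 1) - x k ≤ t} ≤
      ENNReal.ofReal (β * t * K * (c₀ + 4 * A + 4 * D + 12 * K)) := by
  have hβ0 : 0 < β := by linarith
  have hu : 0 < u₀ := by linarith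
  set f : (Fin K → ℝ) → ℝ≥0∞ := fun x => ENNReal.ofReal (condDensity β N K y x) with hf
  have hfm : Measurable f := (measurable_condDensity β N K y).ennreal_ofReal
  have hPapp : ∀ S, MeasurableSet S → P S = Z⁻¹ * ∫⁻ x in S, f x := by
    intro S hS
    rw [hP, Measure.smul_apply, withDensity_apply _ hS, smul_eq_mul]
  have hS : MeasurableSet {x : Fin K → ℝ | y (K + 1) - x k ≤ t} :=
    measurableSet_le (measurable_const.sub (measurable_pi_apply k)) measurable_const
  set S := {x : Fin K → ℝ | y (K + 1) - x k ≤ t} with hSdef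
  set M := β * K * (u₀ * A + D) + β * K ^ 2 + K with hM
  have hM0 : 0 ≤ M := by positivity
  set a := β * t * K * c₀ + 4 * t / u₀ * M with ha
  have ha0 : 0 ≤ a := by positivity
  set b := 4 * t / u₀ * (1 / 2 ^ K) with hb
  have hb0 : 0 ≤ b := by positivity
  have hpt : ∀ x, f x ≤ Sᶜ.indicator f (x - fun _ => t) + ENNReal.ofReal a * f x +
      ENNReal.ofReal b * f (fun i => (x i + c) / 2) := by
    intro x
    by_cases hx : x ∈ orderedBelow K (y (K + 1))
    · have hmem : (x - fun _ => t) ∈ Sᶜ := by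
        have := hx.2 k
        show ¬ (y (K + 1) - (x k - t) ≤ t)
        linarith
      rw [Set.indicator_of_mem hmem]
      have h := condDensity_le_of_shift_of_contraction hβ hN hc ht hu₀ hshift hcontr hx
      have h1 := condDensity_nonneg β N K y x
      have h2 := condDensity_nonneg β N K y (fun i => x i - t)
      have h3 := condDensity_nonneg β N K y (fun i => (x i + c) / 2)
      simp only [hf]
      rw [← ENNReal.ofReal_mul ha0, ← ENNReal.ofReal_mul hb0,
        ← ENNReal.ofReal_add (condDensity_nonneg _ _ _ _ _) (by positivity),
        ← ENNReal.ofReal_add (add_nonneg (condDensity_nonneg _ _ _ _ _) (by positivity))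
          (by positivity)]
      exact ENNReal.ofReal_le_ofReal h
    · simp [hf, condDensity_of_notMem hx]
  have hint : ∫⁻ x, f x ≤ (∫⁻ x in Sᶜ, f x) + ENNReal.ofReal (a + 4 * t / u₀) * ∫⁻ x, f x := by
    calc ∫⁻ x, f x ≤ ∫⁻ x, (Sᶜ.indicator f (x - fun _ => t) + ENNReal.ofReal a * f x +
          ENNReal.ofReal b * f (fun i => (x i + c) / 2)) := lintegral_mono hpt
      _ = (∫⁻ x in Sᶜ, f x) + ENNReal.ofReal a * (∫⁻ x, f x) +
          ENNReal.ofReal b * (ENNReal.ofReal (2 ^ K) * ∫⁻ x, f x) := by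
        have hm : Measurable fun x : Fin K → ℝ => Sᶜ.indicator f (x - fun _ => t) :=
          (hfm.indicator hS.compl).comp (measurable_id.sub_const _)
        have hm' : Measurable fun x : Fin K → ℝ =>
            Sᶜ.indicator f (x - fun _ => t) + ENNReal.ofReal a * f x := hm.add (hfm.const_mul _)
        rw [lintegral_add_left hm', lintegral_add_left hm,
          lintegral_sub_right_eq_self (fun x : Fin K → ℝ => Sᶜ.indicator f x),
          lintegral_indicator hS.compl, lintegral_const_mul' _ _ ENNReal.ofReal_ne_top,
          lintegral_const_mul' _ _ ENNReal.ofReal_ne_top, lintegral_midpoint c hfm]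
      _ = _ := by
        rw [← mul_assoc, ← ENNReal.ofReal_mul hb0, add_assoc, ← add_mul,
          ← ENNReal.ofReal_add ha0 (by positivity)]
        congr 3
        rw [hb]
        field_simp
  have huniv : Z⁻¹ * ∫⁻ x, f x = 1 := by
    have := hPapp Set.univ MeasurableSet.univ
    rw [measure_univ, setLIntegral_univ] at this
    exact this.symm
  have h1 : 1 ≤ P Sᶜ + ENNReal.ofReal (a + 4 * t / u₀) := by
    have := mul_le_mul_right hint Z⁻¹
    rw [mul_add, mul_left_comm, huniv, mul_one, ← hPapp _ hS.compl] at this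
    exact this
  have h2 : P S ≤ ENNReal.ofReal (a + 4 * t / u₀) := by
    have h3 : P S + P Sᶜ = 1 := prob_add_prob_compl hS
    refine ENNReal.le_of_add_le_add_left (measure_ne_top P Sᶜ) ?_
    rw [add_comm, h3]
    exact h1
  refine h2.trans (ENNReal.ofReal_le_ofReal ?_)
  have hK1 : (1 : ℝ) ≤ K := by exact_mod_cast hK
  have h4 : a + 4 * t / u₀ = β * t * K * c₀ + 4 * β * t * K * A +
      4 * t * (β * K * D + β * K ^ 2 + K + 1) / u₀ := by
    rw [ha, hM]
    field_simp
    ring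
  have h5 : 4 * t * (β * K * D + β * K ^ 2 + K + 1) / u₀ ≤
      4 * t * (β * K * D + β * K ^ 2 + K + 1) := div_le_self (by positivity) hu₀
  have h6 : (K : ℝ) + 1 ≤ 2 * (β * K ^ 2) := by nlinarith
  have h7 := mul_le_mul_of_nonneg_left h6 ht.le
  rw [h4]
  linarith

/-- The force on a particle at distance `v` to the left of `Y` exerted by a harmonic confinement of
strength `q` and by the charges at `Y + d j`, `j ∈ s`. -/
noncomputable def netForce (q Y : ℝ) (s : Finset ℕ) (d : ℕ → ℝ) (v : ℝ) : ℝ :=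
  q * (v - Y) - ∑ j ∈ s, 1 / (v + d j)

section NetForce

variable {q Y : ℝ} {s : Finset ℕ} {d : ℕ → ℝ}

lemma netForce_mono (hq : 0 ≤ q) (hd : ∀ j ∈ s, 0 < d j) {v w : ℝ} (hv : 0 ≤ v) (hvw : v ≤ w) :
    netForce q Y s d v ≤ netForce q Y s d w := by
  have h : ∑ j ∈ s, 1 / (w + d j) ≤ ∑ j ∈ s, 1 / (v + d j) := by
    refine Finset.sum_le_sum fun j hj => ?_
    have := hd j hj
    gcongr
  unfold netForce
  nlinarith [mul_le_mul_of_nonneg_left hvw hq]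

lemma netForce_four_mul_le (hd : ∀ j ∈ s, 0 < d j) {v : ℝ} (hv : 0 ≤ v) :
    netForce q Y s d (4 * v) ≤ 4 * netForce q Y s d v - 3 * netForce q Y s d 0 := by
  have h : 4 * ∑ j ∈ s, 1 / (v + d j) ≤
      ∑ j ∈ s, 1 / (4 * v + d j) + 3 * ∑ j ∈ s, 1 / (0 + d j) := by
    rw [Finset.mul_sum, Finset.mul_sum, ← Finset.sum_add_distrib]
    refine Finset.sum_le_sum fun j hj => ?_
    have := hd j hj
    have h1 : 1 / (4 * v + d j) + 3 * (1 / (0 + d j)) - 4 * (1 / (v + d j)) =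
        12 * v ^ 2 / ((4 * v + d j) * d j * (v + d j)) := by
      field_simp
      ring
    have h2 : 0 ≤ 12 * v ^ 2 / ((4 * v + d j) * d j * (v + d j)) := by positivity
    linarith
  unfold netForce
  nlinarith

lemma continuousOn_netForce (hd : ∀ j ∈ s, 0 < d j) :
    ContinuousOn (netForce q Y s d) (Set.Ici 0) := by
  unfold netForce
  refine ContinuousOn.sub (by fun_prop) (continuousOn_finsetSum _ fun j hj => ?_)
  refine ContinuousOn.div continuousOn_const (by fun_prop) fun v hv => ?_
  have := hd j hj
  have : (0 : ℝ) ≤ v := hv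
  positivity

lemma exists_netForce_nonneg (hq : 0 < q) (hd : ∀ j ∈ s, 0 < d j) :
    ∃ u₀, 1 ≤ u₀ ∧ 0 ≤ netForce q Y s d u₀ ∧ ∀ v, 1 < v → v < u₀ → netForce q Y s d v ≤ 0 := by
  by_cases h1 : 0 ≤ netForce q Y s d 1
  · exact ⟨1, le_rfl, h1, fun v hv hv' => absurd hv hv'.not_gt⟩
  push Not at h1
  set S := ∑ j ∈ s, 1 / d j with hS
  have hS0 : 0 ≤ S := Finset.sum_nonneg fun j hj => by have := hd j hj; positivity
  set V := 1 + |Y| + S / q with hV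
  have hV1 : 1 ≤ V := by
    have : 0 ≤ S / q := by positivity
    linarith [abs_nonneg Y]
  have hVpos : 0 ≤ netForce q Y s d V := by
    have h : ∑ j ∈ s, 1 / (V + d j) ≤ S := by
      refine Finset.sum_le_sum fun j hj => ?_
      have := hd j hj
      gcongr
      linarith
    have h2 : S ≤ q * (V - Y) := by
      have h3 : q * (V - Y) = q * (1 + (|Y| - Y)) + S := by
        rw [hV]
        field_simp
        ring
      have h4 : 0 ≤ q * (1 + (|Y| - Y)) := mul_nonneg hq.le (by linarith [le_abs_self Y])
      linarith
    unfold netForce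
    linarith
  obtain ⟨u, hu, hu0⟩ := intermediate_value_Icc hV1
    ((continuousOn_netForce (q := q) (Y := Y) hd).mono fun v hv => by
      have : (1 : ℝ) ≤ v := hv.1
      exact zero_le_one.trans this) ⟨h1.le, hVpos⟩
  exact ⟨u, hu.1, hu0.ge, fun v hv hv' =>
    (netForce_mono hq.le hd (by linarith) hv'.le).trans hu0.le⟩

lemma exists_weight_of_netForce (hq : 0 < q) (hd : ∀ j ∈ s, 0 < d j) {A B : ℝ} (hA : 0 ≤ A)
    (hA' : -A ≤ netForce q Y s d 0) (hB : netForce q Y s d 3 ≤ B) :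
    ∃ (u₀ : ℝ) (ω : ℝ → ℝ), 1 ≤ u₀ ∧ (∀ v, 0 < v → u₀ * (ω v - A) = v * netForce q Y s d v) ∧
      ∀ u, 0 < u → netForce q Y s d (u + 1) ≤ |B| + 3 * A + 4 * ω (u / 2) := by
  obtain ⟨u₀, hu₀, hpos, hneg⟩ := exists_netForce_nonneg (Y := Y) hq hd
  have hu : 0 < u₀ := by linarith
  refine ⟨u₀, fun v => v * netForce q Y s d v / u₀ + A, hu₀, fun v _ => by field_simp; ring, ?_⟩
  have hω : ∀ v, 0 < v → 0 ≤ v * netForce q Y s d v / u₀ + A := by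
    intro v hv
    rw [div_add' _ _ _ hu.ne']
    refine div_nonneg ?_ hu.le
    rcases le_total u₀ v with h | h
    · have := hpos.trans (netForce_mono hq.le hd hu.le h)
      positivity
    · have h1 := hA'.trans (netForce_mono hq.le hd le_rfl hv.le)
      nlinarith
  intro u hu'
  have hω' := hω (u / 2) (by linarith)
  simp only
  rcases le_total u 2 with h | h
  · have := netForce_mono (Y := Y) hq.le hd (show 0 ≤ u + 1 by linarith)
      (show u + 1 ≤ 3 by linarith)
    linarith [le_abs_self B]
  · rcases h.eq_or_lt with rfl | h
    · norm_num at hω' ⊢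
      linarith [le_abs_self B]
    have h1 := netForce_mono (Y := Y) hq.le hd (show 0 ≤ u + 1 by linarith)
      (show u + 1 ≤ 4 * (u / 2) by linarith)
    have h2 := netForce_four_mul_le (q := q) (Y := Y) hd (show 0 ≤ u / 2 by linarith)
    have h3 : netForce q Y s d (u / 2) ≤ u / 2 * netForce q Y s d (u / 2) / u₀ + A := by
      rcases lt_or_ge (u / 2) u₀ with h4 | h4
      · exact (hneg _ (by linarith) h4).trans hω'
      · have h5 := hpos.trans (netForce_mono hq.le hd hu.le h4)
        have h6 : netForce q Y s d (u / 2) ≤ u / 2 * netForce q Y s d (u / 2) / u₀ := by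
          rw [le_div_iff₀ hu]
          nlinarith
        linarith
    linarith [abs_nonneg B]

end NetForce

lemma half_mul_Vy {N : ℕ} (hN : 0 < N) (K : ℕ) (y : ℕ → ℝ) (t : ℝ) :
    (N : ℝ) / 2 * Vy N K y t = (N : ℝ) ^ (-(1 : ℝ) / 3) / 2 * t ^ 2 / 2 -
      ∑ j ∈ Finset.Icc (K + 1) N, Real.log |t - y j| := by
  have hN' : (0 : ℝ) < N := by exact_mod_cast hN
  have h : (N : ℝ) * ((N : ℝ) ^ (-(2 : ℝ) / 3)) ^ 2 = (N : ℝ) ^ (-(1 : ℝ) / 3) := by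
    rw [← Real.rpow_natCast, ← Real.rpow_mul hN'.le, ← Real.rpow_one_add' hN'.le] <;> norm_num
  unfold Vy
  rw [mul_sub, mul_pow, ← h]
  congr 1
  · ring
  · field_simp

section Boundary

variable {N K J : ℕ} {y : ℕ → ℝ}

lemma boundary_sub_nonneg (hy : ∀ j k : ℕ, K + 1 ≤ j → j < k → k ≤ N → y j < y k)
    {j : ℕ} (hj : j ∈ Finset.Icc (K + 1) N) : 0 ≤ y j - y (K + 1) := by
  rw [Finset.mem_Icc] at hj
  rcases hj.1.eq_or_lt with h | h
  · rw [h, sub_self]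
  · linarith [hy (K + 1) j le_rfl h hj.2]

lemma boundary_Ico_subset (hJ : K + 1 ≤ J) : Finset.Ico J N ⊆ Finset.Icc (K + 1) N := by
  intro j hj
  rw [Finset.mem_Ico] at hj
  rw [Finset.mem_Icc]
  omega

lemma Vy_shift_le (hN : 0 < N) (hJ : K + 1 ≤ J)
    (hy : ∀ j k : ℕ, K + 1 ≤ j → j < k → k ≤ N → y j < y k) {x t : ℝ} (ht : 0 < t) (ht1 : t ≤ 1)
    (hx : x < y (K + 1)) :
    (N : ℝ) / 2 * Vy N K y (x - t) - (N : ℝ) / 2 * Vy N K y x ≤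
      t * netForce ((N : ℝ) ^ (-(1 : ℝ) / 3) / 2) (y (K + 1)) (Finset.Ico J N)
        (fun j => y j - y (K + 1)) (y (K + 1) - x + 1) := by
  rw [half_mul_Vy hN, half_mul_Vy hN]
  set q := (N : ℝ) ^ (-(1 : ℝ) / 3) / 2 with hq
  have hq0 : 0 ≤ q := by positivity
  have hlog : ∑ j ∈ Finset.Ico J N, t * (1 / (y (K + 1) - x + 1 + (y j - y (K + 1)))) ≤
      ∑ j ∈ Finset.Icc (K + 1) N, (Real.log |x - t - y j| - Real.log |x - y j|) := by
    have key : ∀ j ∈ Finset.Icc (K + 1) N, t * (1 / (y (K + 1) - x + 1 + (y j - y (K + 1)))) ≤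
        Real.log |x - t - y j| - Real.log |x - y j| := by
      intro j hj
      have h0 := boundary_sub_nonneg hy hj
      set w := y j - x with hw
      have hw0 : 0 < w := by linarith
      rw [abs_of_neg (by linarith), abs_of_neg (by linarith)]
      have e1 : -(x - t - y j) = w + t := by rw [hw]; ring
      have e2 : -(x - y j) = w := by rw [hw]; ring
      have e3 : y (K + 1) - x + 1 + (y j - y (K + 1)) = w + 1 := by rw [hw]; ring
      rw [e1, e2, e3, ← Real.log_div (by positivity) (by positivity)]
      have h1 := Real.one_sub_inv_le_log_of_pos (show 0 < (w + t) / w by positivity)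
      have h2 : 1 - ((w + t) / w)⁻¹ = t * (1 / (w + t)) := by
        field_simp
        ring
      rw [h2] at h1
      refine le_trans ?_ h1
      gcongr
    refine (Finset.sum_le_sum fun j hj => key j (boundary_Ico_subset hJ hj)).trans ?_
    refine Finset.sum_le_sum_of_subset_of_nonneg (boundary_Ico_subset hJ) fun j hj _ => ?_
    refine le_trans ?_ (key j hj)
    have h0 := boundary_sub_nonneg hy hj
    have : 0 < y (K + 1) - x + 1 + (y j - y (K + 1)) := by linarith
    positivity
  rw [Finset.sum_sub_distrib, ← Finset.mul_sum] at hlog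
  have hquad : q * (x - t) ^ 2 / 2 - q * x ^ 2 / 2 ≤ t * (q * (y (K + 1) - x + 1 - y (K + 1))) := by
    have : 0 ≤ q * t := by positivity
    nlinarith
  unfold netForce
  linarith

lemma Vy_contraction_ge (hN : 0 < N) (hJ : K + 1 ≤ J)
    (hy : ∀ j k : ℕ, K + 1 ≤ j → j < k → k ≤ N → y j < y k) {x : ℝ} (hx : x < y (K + 1)) :
    (y (K + 1) - x) / 2 * netForce ((N : ℝ) ^ (-(1 : ℝ) / 3) / 2) (y (K + 1)) (Finset.Ico J N)
        (fun j => y j - y (K + 1)) ((y (K + 1) - x) / 2) - J ≤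
      (N : ℝ) / 2 * Vy N K y x - (N : ℝ) / 2 * Vy N K y ((x + y (K + 1)) / 2) := by
  rw [half_mul_Vy hN, half_mul_Vy hN]
  set q := (N : ℝ) ^ (-(1 : ℝ) / 3) / 2 with hq
  have hq0 : 0 ≤ q := by positivity
  set v := (y (K + 1) - x) / 2 with hv
  have hv0 : 0 < v := by rw [hv]; linarith
  have hlog : ∑ j ∈ Finset.Icc (K + 1) N,
      (Real.log |x - y j| - Real.log |(x + y (K + 1)) / 2 - y j|) ≤
      ∑ j ∈ Finset.Ico J N, v * (1 / (v + (y j - y (K + 1)))) + J := by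
    have key : ∀ j ∈ Finset.Icc (K + 1) N,
        Real.log |x - y j| - Real.log |(x + y (K + 1)) / 2 - y j| ≤
          v * (1 / (v + (y j - y (K + 1)))) := by
      intro j hj
      have h0 := boundary_sub_nonneg hy hj
      set d := y j - y (K + 1) with hd
      rw [abs_of_neg (by linarith), abs_of_neg (by linarith)]
      have e1 : -(x - y j) = 2 * v + d := by rw [hd, hv]; ring
      have e2 : -((x + y (K + 1)) / 2 - y j) = v + d := by rw [hd, hv]; ring
      rw [e1, e2, ← Real.log_div (by positivity) (by positivity)]
      refine (Real.log_le_sub_one_of_pos (by positivity)).trans (le_of_eq ?_)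
      field_simp
      ring
    rw [← Finset.sum_sdiff (boundary_Ico_subset hJ), add_comm]
    refine add_le_add (Finset.sum_le_sum fun j hj => key j (boundary_Ico_subset hJ hj)) ?_
    have hcard : (Finset.Icc (K + 1) N \ Finset.Ico J N).card ≤ J := by
      have hsub : Finset.Icc (K + 1) N \ Finset.Ico J N ⊆ insert N (Finset.Ico (K + 1) J) := by
        intro j hj
        simp only [Finset.mem_sdiff, Finset.mem_Icc, Finset.mem_Ico, Finset.mem_insert] at hj ⊢
        omega
      refine (Finset.card_le_card hsub).trans ((Finset.card_insert_le _ _).trans ?_)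
      rw [Nat.card_Ico]
      omega
    calc _ ≤ ∑ j ∈ Finset.Icc (K + 1) N \ Finset.Ico J N, (1 : ℝ) := by
          refine Finset.sum_le_sum fun j hj => ?_
          have hj' := (Finset.mem_sdiff.1 hj).1
          refine (key j hj').trans ?_
          have h0 := boundary_sub_nonneg hy hj'
          rw [mul_one_div, div_le_one (by positivity)]
          linarith
      _ ≤ J := by
          simp only [Finset.sum_const, nsmul_eq_mul, mul_one]
          exact_mod_cast hcard
  rw [Finset.sum_sub_distrib, ← Finset.mul_sum] at hlog
  have hquad : v * (q * (v - y (K + 1))) ≤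
      q * x ^ 2 / 2 - q * ((x + y (K + 1)) / 2) ^ 2 / 2 := by
    have e : x = y (K + 1) - 2 * v := by rw [hv]; ring
    have h2 : 0 ≤ q * v ^ 2 := by positivity
    rw [e]
    nlinarith
  unfold netForce
  linarith

end Boundary

section Semicircle

lemma semicircle_eq (E : ℝ) : semicircle E = Real.sqrt (4 - E ^ 2) / (2 * Real.pi) := by
  unfold semicircle
  split_ifs with h
  · rfl
  · rw [Real.sqrt_eq_zero_of_nonpos, zero_div]
    push Not at h
    nlinarith [sq_abs E]

lemma continuous_semicircle : Continuous semicircle := by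
  have : semicircle = fun E => Real.sqrt (4 - E ^ 2) / (2 * Real.pi) := funext semicircle_eq
  rw [this]
  fun_prop

lemma semicircle_nonneg (E : ℝ) : 0 ≤ semicircle E := by
  rw [semicircle_eq]
  positivity

/-- The cumulative distribution function of the semicircle law. -/
noncomputable def semicircleCDF (E : ℝ) : ℝ := ∫ x in (-2 : ℝ)..E, semicircle x

lemma semicircleCDF_sub (a b : ℝ) :
    semicircleCDF b - semicircleCDF a = ∫ x in a..b, semicircle x :=
  intervalIntegral.integral_interval_sub_left
    (continuous_semicircle.intervalIntegrable _ _) (continuous_semicircle.intervalIntegrable _ _)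

lemma hasDerivAt_semicircleCDF (E : ℝ) : HasDerivAt semicircleCDF (semicircle E) E :=
  intervalIntegral.integral_hasDerivAt_right (continuous_semicircle.intervalIntegrable _ _)
    (continuous_semicircle.stronglyMeasurableAtFilter _ _) continuous_semicircle.continuousAt

lemma semicircleCDF_mono : Monotone semicircleCDF :=
  monotone_of_hasDerivAt_nonneg hasDerivAt_semicircleCDF semicircle_nonneg

lemma semicircleCDF_neg_two : semicircleCDF (-2) = 0 := intervalIntegral.integral_same

lemma semicircleCDF_two : semicircleCDF 2 = 1 := by
  have h := intervalIntegral.mul_integral_comp_mul_left (a := -1) (b := 1)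
    (f := semicircle) (2 : ℝ)
  have h2 : ∀ x : ℝ, semicircle (2 * x) = Real.sqrt (1 - x ^ 2) / Real.pi := by
    intro x
    rw [semicircle_eq, show 4 - (2 * x) ^ 2 = 2 ^ 2 * (1 - x ^ 2) by ring,
      Real.sqrt_mul (by norm_num), Real.sqrt_sq (by norm_num)]
    field_simp
  simp only [h2, intervalIntegral.integral_div, integral_sqrt_one_sub_sq] at h
  norm_num at h
  unfold semicircleCDF
  rw [← h]
  field_simp

lemma semicircleCDF_le {E : ℝ} (hE : -2 ≤ E) : semicircleCDF E ≤ (E + 2) * Real.sqrt (E + 2) := by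
  have h : semicircleCDF E ≤ ∫ _x in (-2 : ℝ)..E, Real.sqrt (E + 2) := by
    refine intervalIntegral.integral_mono_on hE (continuous_semicircle.intervalIntegrable _ _)
      (by simp) fun x hx => ?_
    rw [semicircle_eq, div_le_iff₀ (by positivity)]
    have h1 : Real.sqrt (4 - x ^ 2) ≤ Real.sqrt (2 ^ 2 * (E + 2)) := by
      apply Real.sqrt_le_sqrt
      nlinarith [hx.1, hx.2]
    rw [Real.sqrt_mul (by norm_num), Real.sqrt_sq (by norm_num)] at h1
    nlinarith [Real.sqrt_nonneg (E + 2), Real.pi_gt_three]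
  rw [intervalIntegral.integral_const, smul_eq_mul] at h
  linarith

lemma le_semicircleCDF {E : ℝ} (hE : -2 ≤ E) (hE2 : E ≤ 2) :
    (E + 2) * Real.sqrt (E + 2) ≤ 64 * semicircleCDF E := by
  set k := E + 2 with hk
  have hk0 : 0 ≤ k := by linarith
  have h1 : semicircleCDF (-2 + k / 2) ≤ semicircleCDF E := semicircleCDF_mono (by linarith)
  have h0 : 0 ≤ semicircleCDF (-2 + k / 4) := by
    rw [← semicircleCDF_neg_two]
    exact semicircleCDF_mono (by linarith)
  have h2 : ∫ _x in (-2 + k / 4)..(-2 + k / 2), Real.sqrt k / 16 ≤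
      semicircleCDF (-2 + k / 2) - semicircleCDF (-2 + k / 4) := by
    rw [semicircleCDF_sub]
    refine intervalIntegral.integral_mono_on (by linarith) (by simp)
      (continuous_semicircle.intervalIntegrable _ _) fun x hx => ?_
    rw [semicircle_eq, div_le_div_iff₀ (by norm_num) (by positivity)]
    have h3 : Real.sqrt ((1 / 2) ^ 2 * k) ≤ Real.sqrt (4 - x ^ 2) := by
      apply Real.sqrt_le_sqrt
      nlinarith [hx.1, hx.2]
    rw [Real.sqrt_mul (by norm_num), Real.sqrt_sq (by norm_num)] at h3
    nlinarith [Real.sqrt_nonneg k, Real.pi_lt_four]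
  rw [intervalIntegral.integral_const, smul_eq_mul] at h2
  linarith

/-- A primitive of `semicircle E / (E + 2)` on `[-2, 2]`. -/
noncomputable def edgePrimitive (E : ℝ) : ℝ :=
  (Real.sqrt (4 - E ^ 2) + 2 * Real.arcsin (E / 2)) / (2 * Real.pi)

lemma edgePrimitive_two : edgePrimitive 2 = 1 / 2 := by
  unfold edgePrimitive
  norm_num
  field_simp

lemma edgePrimitive_neg_two : edgePrimitive (-2) = -(1 / 2) := by
  unfold edgePrimitive
  norm_num
  field_simp

lemma continuous_edgePrimitive : Continuous edgePrimitive := by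
  unfold edgePrimitive
  have := Real.continuous_arcsin
  fun_prop

lemma hasDerivAt_edgePrimitive {E : ℝ} (h : -2 < E) (h' : E < 2) :
    HasDerivAt edgePrimitive (semicircle E / (E + 2)) E := by
  have hpos : 0 < 4 - E ^ 2 := by nlinarith
  have h1 : HasDerivAt (fun x : ℝ => Real.sqrt (4 - x ^ 2))
      (-(2 * E) / (2 * Real.sqrt (4 - E ^ 2))) E := by
    have h := ((hasDerivAt_pow 2 E).const_sub 4).sqrt hpos.ne'
    simpa using h
  have h2 : HasDerivAt (fun x : ℝ => Real.arcsin (x / 2))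
      (1 / Real.sqrt (1 - (E / 2) ^ 2) * (1 / 2)) E :=
    (Real.hasDerivAt_arcsin (by intro h; linarith) (by intro h; linarith)).comp E
      ((hasDerivAt_id E).div_const 2)
  have h3 := (h1.add (h2.const_mul 2)).div_const (2 * Real.pi)
  refine h3.congr_deriv ?_
  have hs : Real.sqrt (1 - (E / 2) ^ 2) = Real.sqrt (4 - E ^ 2) / 2 := by
    rw [show 1 - (E / 2) ^ 2 = (4 - E ^ 2) / 2 ^ 2 by ring, Real.sqrt_div hpos.le,
      Real.sqrt_sq (by norm_num)]
  have hr : 0 < Real.sqrt (4 - E ^ 2) := Real.sqrt_pos.2 hpos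
  have hE : 0 < E + 2 := by linarith
  rw [hs, semicircle_eq]
  have hsq := Real.sq_sqrt hpos.le
  field_simp
  rw [hsq]
  ring

lemma le_of_hasDerivAt_nonneg {f f' : ℝ → ℝ} {a b : ℝ} (hab : a ≤ b)
    (hf : ContinuousOn f (Set.Icc a b)) (hf' : ∀ x ∈ Set.Ioo a b, HasDerivAt f (f' x) x)
    (h0 : ∀ x ∈ Set.Ioo a b, 0 ≤ f' x) : f a ≤ f b := by
  refine monotoneOn_of_deriv_nonneg (convex_Icc a b) hf ?_ ?_ (Set.left_mem_Icc.2 hab)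
    (Set.right_mem_Icc.2 hab) hab
  · rw [interior_Icc]
    exact fun x hx => (hf' x hx).differentiableAt.differentiableWithinAt
  · rw [interior_Icc]
    exact fun x hx => (hf' x hx).deriv ▸ h0 x hx

lemma edgePrimitive_le {a b : ℝ} (ha : -2 ≤ a) (hab : a ≤ b) (hb : b ≤ 2) :
    edgePrimitive a ≤ edgePrimitive b := by
  refine le_of_hasDerivAt_nonneg hab continuous_edgePrimitive.continuousOn
    (fun x hx => hasDerivAt_edgePrimitive (by linarith [hx.1]) (by linarith [hx.2])) fun x hx => ?_
  have : 0 < x + 2 := by linarith [hx.1]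
  have := semicircle_nonneg x
  positivity

lemma continuous_semicircleCDF : Continuous semicircleCDF :=
  continuous_iff_continuousAt.2 fun E => (hasDerivAt_semicircleCDF E).continuousAt

lemma edgePrimitive_sub_le {a b : ℝ} (ha : -2 < a) (hab : a ≤ b) (hb : b ≤ 2) :
    edgePrimitive b - edgePrimitive a ≤ (semicircleCDF b - semicircleCDF a) / (a + 2) := by
  have h := le_of_hasDerivAt_nonneg (f := fun x => semicircleCDF x / (a + 2) - edgePrimitive x)
    hab ((continuous_semicircleCDF.div_const _).sub continuous_edgePrimitive).continuousOn
    (fun x hx => ((hasDerivAt_semicircleCDF x).div_const (a + 2)).sub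
      (hasDerivAt_edgePrimitive (by linarith [hx.1]) (by linarith [hx.2]))) fun x hx => by
      have h1 : a + 2 ≤ x + 2 := by linarith [hx.1]
      have h2 := div_le_div_of_nonneg_left (semicircle_nonneg x) (show 0 < a + 2 by linarith) h1
      linarith
  rw [sub_div]
  linarith

lemma le_edgePrimitive_sub {a b : ℝ} (ha : -2 ≤ a) (hab : a ≤ b) (hb : b ≤ 2) :
    (semicircleCDF b - semicircleCDF a) / (b + 2) ≤ edgePrimitive b - edgePrimitive a := by
  have h := le_of_hasDerivAt_nonneg (f := fun x => edgePrimitive x - semicircleCDF x / (b + 2))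
    hab (continuous_edgePrimitive.sub (continuous_semicircleCDF.div_const _)).continuousOn
    (fun x hx => (hasDerivAt_edgePrimitive (by linarith [hx.1]) (by linarith [hx.2])).sub
      ((hasDerivAt_semicircleCDF x).div_const (b + 2))) fun x hx => by
      have h1 : x + 2 ≤ b + 2 := by linarith [hx.2]
      have h2 := div_le_div_of_nonneg_left (semicircle_nonneg x)
        (show 0 < x + 2 by linarith [hx.1]) h1
      linarith
  rw [sub_div]
  linarith

lemma edgePrimitive_le_sqrt {E : ℝ} (hE : -2 ≤ E) (hE2 : E ≤ 2) :
    edgePrimitive E + 1 / 2 ≤ Real.sqrt (E + 2) := by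
  have h := le_of_hasDerivAt_nonneg (f := fun x => Real.sqrt (x + 2) - edgePrimitive x) hE
    ((by fun_prop : Continuous fun x : ℝ => Real.sqrt (x + 2)).sub
      continuous_edgePrimitive).continuousOn
    (fun x hx => (((hasDerivAt_id x).add_const 2).sqrt
      (by have := hx.1; simp only [id]; linarith)).sub
      (hasDerivAt_edgePrimitive (by linarith [hx.1]) (by linarith [hx.2]))) fun x hx => by
      have h0 : 0 < x + 2 := by linarith [hx.1]
      have h1 : Real.sqrt (4 - x ^ 2) ≤ 2 * Real.sqrt (x + 2) := by
        have h2 : Real.sqrt (4 - x ^ 2) ≤ Real.sqrt (2 ^ 2 * (x + 2)) := by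
          apply Real.sqrt_le_sqrt
          nlinarith [hx.1, hx.2]
        rwa [Real.sqrt_mul (by norm_num), Real.sqrt_sq (by norm_num)] at h2
      have hs : 0 < Real.sqrt (x + 2) := Real.sqrt_pos.2 h0
      have hsq := Real.sq_sqrt h0.le
      simp only [id]
      rw [semicircle_eq, sub_nonneg, div_div, div_le_div_iff₀ (by positivity) (by positivity)]
      nlinarith [Real.pi_gt_three, mul_le_mul_of_nonneg_right h1 hs.le]
  simp only [edgePrimitive_neg_two] at h
  norm_num at h
  linarith

end Semicircle

lemma sum_rpow_neg_four_thirds_le (s : Finset ℕ) :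
    ∑ j ∈ s, (j : ℝ) ^ (-(4 : ℝ) / 3) ≤ ∑' j : ℕ, (j : ℝ) ^ (-(4 : ℝ) / 3) :=
  (Real.summable_nat_rpow.2 (by norm_num)).sum_le_tsum s fun _ _ => by positivity

section Quantiles

variable {N : ℕ} {γ : ℕ → ℝ}

lemma neg_two_lt_quantile (hγ : ∀ k : ℕ, 1 ≤ k → k ≤ N → (k : ℝ) / N = semicircleCDF (γ k))
    {k : ℕ} (hk : 1 ≤ k) (hkN : k ≤ N) : -2 < γ k := by
  by_contra! h
  have h1 := semicircleCDF_mono h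
  rw [semicircleCDF_neg_two, ← hγ k hk hkN] at h1
  have hk0 : (0 : ℝ) < k := by exact_mod_cast hk
  have hN0 : (0 : ℝ) < N := by exact_mod_cast (show 0 < N by omega)
  have : 0 < (k : ℝ) / N := by positivity
  linarith

lemma quantile_lt_two (hγ : ∀ k : ℕ, 1 ≤ k → k ≤ N → (k : ℝ) / N = semicircleCDF (γ k))
    {k : ℕ} (hk : 1 ≤ k) (hkN : k < N) : γ k < 2 := by
  by_contra! h
  have h1 := semicircleCDF_mono h
  have hN0 : (0 : ℝ) < N := by exact_mod_cast (show 0 < N by omega)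
  have hkN' : (k : ℝ) < N := by exact_mod_cast hkN
  rw [semicircleCDF_two, ← hγ k hk hkN.le, le_div_iff₀ hN0] at h1
  linarith

lemma two_le_quantile_self (hN : 1 ≤ N)
    (hγ : ∀ k : ℕ, 1 ≤ k → k ≤ N → (k : ℝ) / N = semicircleCDF (γ k)) : 2 ≤ γ N := by
  by_contra! h
  have h0 := neg_two_lt_quantile hγ hN le_rfl
  have h1 : StrictMonoOn semicircleCDF (Set.Icc (γ N) 2) := by
    refine strictMonoOn_of_deriv_pos (convex_Icc _ _) continuous_semicircleCDF.continuousOn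
      fun x hx => ?_
    rw [interior_Icc] at hx
    rw [(hasDerivAt_semicircleCDF x).deriv, semicircle_eq]
    have : 0 < 4 - x ^ 2 := by nlinarith [hx.1, hx.2]
    have := Real.sqrt_pos.2 this
    positivity
  have h2 := h1 (Set.left_mem_Icc.2 h.le) (Set.right_mem_Icc.2 h.le) h
  have hN0 : (N : ℝ) ≠ 0 := by exact_mod_cast (show N ≠ 0 by omega)
  rw [semicircleCDF_two, ← hγ N hN le_rfl, div_self hN0] at h2
  exact lt_irrefl _ h2

lemma quantile_le_quantile
    (hγ : ∀ k : ℕ, 1 ≤ k → k ≤ N → (k : ℝ) / N = semicircleCDF (γ k))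
    {j k : ℕ} (hj : 1 ≤ j) (hjk : j ≤ k) (hk : k ≤ N) : γ j ≤ γ k := by
  rcases hjk.eq_or_lt with rfl | hjk
  · exact le_rfl
  by_contra! h
  have h1 := semicircleCDF_mono h.le
  rw [← hγ j hj (by omega), ← hγ k (by omega) hk] at h1
  have hN0 : (0 : ℝ) < N := by exact_mod_cast (show 0 < N by omega)
  have := (div_le_div_iff_of_pos_right hN0).1 h1
  have : k ≤ j := by exact_mod_cast this
  omega

lemma natCast_mul_mul_sqrt {κ : ℝ} (hκ : 0 ≤ κ) (N : ℕ) :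
    (N : ℝ) * (κ * Real.sqrt κ) = ((N : ℝ) ^ ((2 : ℝ) / 3) * κ) ^ ((3 : ℝ) / 2) := by
  rw [Real.mul_rpow (by positivity) hκ, ← Real.rpow_mul (by positivity), Real.sqrt_eq_rpow,
    ← Real.rpow_one_add' hκ (by norm_num)]
  norm_num

lemma rpow_le_scaled_quantile
    (hγ : ∀ k : ℕ, 1 ≤ k → k ≤ N → (k : ℝ) / N = semicircleCDF (γ k))
    {k : ℕ} (hk : 1 ≤ k) (hkN : k ≤ N) :
    (k : ℝ) ^ ((2 : ℝ) / 3) ≤ (N : ℝ) ^ ((2 : ℝ) / 3) * (γ k + 2) := by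
  have h0 := neg_two_lt_quantile hγ hk hkN
  have hN0 : (0 : ℝ) < N := by exact_mod_cast (show 0 < N by omega)
  have hκ : 0 ≤ γ k + 2 := by linarith
  have h1 := semicircleCDF_le h0.le
  rw [← hγ k hk hkN, div_le_iff₀ hN0, mul_comm, natCast_mul_mul_sqrt hκ] at h1
  have h2 := Real.rpow_le_rpow (by positivity) h1 (show (0 : ℝ) ≤ 2 / 3 by norm_num)
  rw [← Real.rpow_mul (by positivity)] at h2
  norm_num at h2
  exact h2

lemma scaled_quantile_le
    (hγ : ∀ k : ℕ, 1 ≤ k → k ≤ N → (k : ℝ) / N = semicircleCDF (γ k))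
    {k : ℕ} (hk : 1 ≤ k) (hkN : k < N) :
    (N : ℝ) ^ ((2 : ℝ) / 3) * (γ k + 2) ≤ 16 * (k : ℝ) ^ ((2 : ℝ) / 3) := by
  have h0 := neg_two_lt_quantile hγ hk hkN.le
  have hN0 : (0 : ℝ) < N := by exact_mod_cast (show 0 < N by omega)
  have hκ : 0 ≤ γ k + 2 := by linarith
  have h1 := le_semicircleCDF h0.le (quantile_lt_two hγ hk hkN).le
  rw [← hγ k hk hkN.le, ← mul_div_assoc, le_div_iff₀ hN0, mul_comm, natCast_mul_mul_sqrt hκ] at h1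
  have h2 := Real.rpow_le_rpow (by positivity) h1 (show (0 : ℝ) ≤ 2 / 3 by norm_num)
  have h3 : ((64 : ℝ) * k) ^ ((2 : ℝ) / 3) = 16 * (k : ℝ) ^ ((2 : ℝ) / 3) := by
    rw [Real.mul_rpow (by norm_num) (by positivity),
      show (64 : ℝ) = 4 ^ (3 : ℝ) by norm_num, ← Real.rpow_mul (by norm_num)]
    norm_num
  rw [← Real.rpow_mul (by positivity), h3] at h2
  norm_num at h2
  exact h2

lemma one_div_scaled_quantile {κ : ℝ} (hN : 0 < N) :
    1 / ((N : ℝ) ^ ((2 : ℝ) / 3) * κ) = (N : ℝ) ^ ((1 : ℝ) / 3) * ((1 / N) / κ) := by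
  have hN0 : (0 : ℝ) < N := by exact_mod_cast hN
  have h : (N : ℝ) ^ ((2 : ℝ) / 3) * (N : ℝ) ^ ((1 : ℝ) / 3) = N := by
    rw [← Real.rpow_add hN0]
    norm_num
  rcases eq_or_ne κ 0 with rfl | hκ
  · simp
  have h2 : (N : ℝ) ^ ((2 : ℝ) / 3) ≠ 0 := by positivity
  field_simp
  linarith

lemma semicircleCDF_quantile_succ_sub
    (hγ : ∀ k : ℕ, 1 ≤ k → k ≤ N → (k : ℝ) / N = semicircleCDF (γ k))
    {k : ℕ} (hk : 1 ≤ k) (hkN : k + 1 ≤ N) :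
    semicircleCDF (γ (k + 1)) - semicircleCDF (γ k) = 1 / N := by
  rw [← hγ k hk (by omega), ← hγ (k + 1) (by omega) hkN]
  push_cast
  ring

lemma sum_one_div_scaled_quantile_le
    (hγ : ∀ k : ℕ, 1 ≤ k → k ≤ N → (k : ℝ) / N = semicircleCDF (γ k)) {J : ℕ} (hJ : 2 ≤ J) :
    ∑ j ∈ Finset.Ico J N, 1 / ((N : ℝ) ^ ((2 : ℝ) / 3) * (γ j + 2)) ≤ (N : ℝ) ^ ((1 : ℝ) / 3) := by
  rcases le_or_gt N J with hJN | hJN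
  · rw [Finset.Ico_eq_empty (by omega), Finset.sum_empty]
    positivity
  have key : ∀ j ∈ Finset.Ico J N, 1 / ((N : ℝ) ^ ((2 : ℝ) / 3) * (γ j + 2)) ≤
      (N : ℝ) ^ ((1 : ℝ) / 3) *
        (edgePrimitive (γ (j + 1 - 1)) - edgePrimitive (γ (j - 1))) := by
    intro j hj
    rw [Finset.mem_Ico] at hj
    obtain ⟨i, rfl⟩ : ∃ i, j = i + 1 := ⟨j - 1, by omega⟩
    rw [one_div_scaled_quantile (by omega)]
    simp only [Nat.add_sub_cancel]
    gcongr
    rw [← semicircleCDF_quantile_succ_sub hγ (show 1 ≤ i by omega) (by omega)]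
    exact le_edgePrimitive_sub (neg_two_lt_quantile hγ (by omega) (by omega)).le
      (quantile_le_quantile hγ (by omega) (by omega) (by omega))
      (quantile_lt_two hγ (by omega) (by omega)).le
  refine (Finset.sum_le_sum key).trans ?_
  rw [← Finset.mul_sum, Finset.sum_Ico_sub (fun j => edgePrimitive (γ (j - 1))) hJN.le]
  have h1 := edgePrimitive_le (neg_two_lt_quantile hγ (show 1 ≤ N - 1 by omega) (by omega)).le
    (quantile_lt_two hγ (show 1 ≤ N - 1 by omega) (by omega)).le le_rfl
  have h2 := edgePrimitive_le le_rfl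
    (neg_two_lt_quantile hγ (show 1 ≤ J - 1 by omega) (by omega)).le
    (quantile_lt_two hγ (show 1 ≤ J - 1 by omega) (by omega)).le
  rw [edgePrimitive_two] at h1
  rw [edgePrimitive_neg_two] at h2
  exact mul_le_of_le_one_right (by positivity) (by linarith)

lemma le_sum_one_div_scaled_quantile
    (hγ : ∀ k : ℕ, 1 ≤ k → k ≤ N → (k : ℝ) / N = semicircleCDF (γ k)) {J : ℕ} (hJ : 1 ≤ J) :
    (N : ℝ) ^ ((1 : ℝ) / 3) - 4 * J ≤
      ∑ j ∈ Finset.Ico J N, 1 / ((N : ℝ) ^ ((2 : ℝ) / 3) * (γ j + 2)) := by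
  have hJ1 : (1 : ℝ) ≤ J := by exact_mod_cast hJ
  rcases le_or_gt N J with hJN | hJN
  · rw [Finset.Ico_eq_empty (by omega), Finset.sum_empty]
    have h1 : (N : ℝ) ^ ((1 : ℝ) / 3) ≤ (J : ℝ) ^ ((1 : ℝ) / 3) := by gcongr
    have h2 : (J : ℝ) ^ ((1 : ℝ) / 3) ≤ (J : ℝ) ^ (1 : ℝ) :=
      Real.rpow_le_rpow_of_exponent_le hJ1 (by norm_num)
    rw [Real.rpow_one] at h2
    linarith
  have hN0 : (0 : ℝ) < N := by exact_mod_cast (show 0 < N by omega)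
  set δ : ℕ → ℝ := Function.update γ N 2 with hδ
  have hδγ : ∀ j, j < N → δ j = γ j := fun j hj => Function.update_of_ne hj.ne _ _
  have hδN : δ N = 2 := Function.update_self _ _ _
  have hδ' : ∀ k : ℕ, 1 ≤ k → k ≤ N → (k : ℝ) / N = semicircleCDF (δ k) := by
    intro k hk hkN
    rcases hkN.eq_or_lt with rfl | h
    · rw [hδN, semicircleCDF_two, div_self hN0.ne']
    · rw [hδγ k h]
      exact hγ k hk hkN
  have hδ2 : ∀ k : ℕ, 1 ≤ k → k ≤ N → δ k ≤ 2 := by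
    intro k hk hkN
    rcases hkN.eq_or_lt with rfl | h
    · exact hδN.le
    · exact (quantile_lt_two hδ' hk h).le
  have key : ∀ j ∈ Finset.Ico J N, (N : ℝ) ^ ((1 : ℝ) / 3) *
      (edgePrimitive (δ (j + 1)) - edgePrimitive (δ j)) ≤
        1 / ((N : ℝ) ^ ((2 : ℝ) / 3) * (γ j + 2)) := by
    intro j hj
    rw [Finset.mem_Ico] at hj
    rw [one_div_scaled_quantile (by omega), ← hδγ j hj.2]
    gcongr
    rw [← semicircleCDF_quantile_succ_sub hδ' (show 1 ≤ j by omega) (by omega)]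
    exact edgePrimitive_sub_le (neg_two_lt_quantile hδ' (by omega) (by omega))
      (quantile_le_quantile hδ' (by omega) (by omega) (by omega)) (hδ2 _ (by omega) (by omega))
  refine le_trans ?_ (Finset.sum_le_sum key)
  rw [← Finset.mul_sum, Finset.sum_Ico_sub (fun j => edgePrimitive (δ j)) hJN.le, hδN,
    edgePrimitive_two, hδγ J hJN]
  have h0 := (neg_two_lt_quantile hγ hJ hJN.le).le
  have h1 := edgePrimitive_le_sqrt h0 (quantile_lt_two hγ hJ hJN).le
  have h2 : (N : ℝ) ^ ((1 : ℝ) / 3) * Real.sqrt (γ J + 2) ≤ 4 * J := by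
    have e : (N : ℝ) ^ ((1 : ℝ) / 3) * Real.sqrt (γ J + 2) =
        Real.sqrt ((N : ℝ) ^ ((2 : ℝ) / 3) * (γ J + 2)) := by
      rw [Real.sqrt_mul (by positivity), Real.sqrt_eq_rpow ((N : ℝ) ^ _),
        ← Real.rpow_mul hN0.le]
      norm_num
    rw [e, Real.sqrt_le_left (by positivity)]
    refine (scaled_quantile_le hγ hJ hJN).trans ?_
    have h3 : (J : ℝ) ^ ((2 : ℝ) / 3) ≤ (J : ℝ) ^ (2 : ℝ) :=
      Real.rpow_le_rpow_of_exponent_le hJ1 (by norm_num)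
    norm_num at h3 ⊢
    linarith
  have h3 : (0 : ℝ) ≤ (N : ℝ) ^ ((1 : ℝ) / 3) := by positivity
  nlinarith [mul_le_mul_of_nonneg_left h1 h3]

end Quantiles

section Rigidity

variable {N K J : ℕ} {γ y : ℕ → ℝ} {X : ℝ}

lemma thirtytwo_mul_add_le_rpow {n X : ℝ} {j : ℕ} (hn : 0 ≤ n) (hX : 1 ≤ X)
    (h : 512 * n + 64 * X ^ 2 ≤ j) :
    2 * (16 * n ^ ((2 : ℝ) / 3) + 2 * X) ≤ (j : ℝ) ^ ((2 : ℝ) / 3) := by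
  have h1 : (512 * n) ^ ((2 : ℝ) / 3) ≤ (j : ℝ) ^ ((2 : ℝ) / 3) := by
    gcongr
    nlinarith
  have h2 : (64 * X ^ 2) ^ ((2 : ℝ) / 3) ≤ (j : ℝ) ^ ((2 : ℝ) / 3) := by
    gcongr
    nlinarith
  have e1 : (512 * n) ^ ((2 : ℝ) / 3) = 64 * n ^ ((2 : ℝ) / 3) := by
    rw [Real.mul_rpow (by norm_num) hn, show (512 : ℝ) = 8 ^ (3 : ℝ) by norm_num,
      ← Real.rpow_mul (by norm_num)]
    norm_num
  have e2 : 16 * X ≤ (64 * X ^ 2) ^ ((2 : ℝ) / 3) := by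
    rw [Real.mul_rpow (by norm_num) (by positivity), show (64 : ℝ) = 4 ^ (3 : ℝ) by norm_num,
      ← Real.rpow_mul (by norm_num), ← Real.rpow_natCast, ← Real.rpow_mul (by linarith)]
    have : X ^ (1 : ℝ) ≤ X ^ (((2 : ℕ) : ℝ) * (2 / 3)) :=
      Real.rpow_le_rpow_of_exponent_le hX (by norm_num)
    rw [Real.rpow_one] at this
    norm_num at this ⊢
    exact this
  linarith

/-- The boundary charges beyond `J` balance the confinement at the edge, up to an error. -/
lemma netForce_bounds (hN : 0 < N) (hKN : K + 1 < N)
    (hγ : ∀ k : ℕ, 1 ≤ k → k ≤ N → (k : ℝ) / N = semicircleCDF (γ k)) (hX : 1 ≤ X)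
    (hyγ : ∀ k : ℕ, K + 1 ≤ k → k ≤ N → |y k - (N : ℝ) ^ ((2 : ℝ) / 3) * γ k| ≤ X)
    (hJ : 512 * ((K : ℝ) + 1) + 64 * X ^ 2 ≤ J) (hJK : K + 2 ≤ J) :
    -((16 * ((K : ℝ) + 1) + 2 * X) * (1 + 2 * ∑' j : ℕ, (j : ℝ) ^ (-(4 : ℝ) / 3))) ≤
      netForce ((N : ℝ) ^ (-(1 : ℝ) / 3) / 2) (y (K + 1)) (Finset.Ico J N)
        (fun j => y j - y (K + 1)) 0 ∧
    netForce ((N : ℝ) ^ (-(1 : ℝ) / 3) / 2) (y (K + 1)) (Finset.Ico J N)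
        (fun j => y j - y (K + 1)) 3 ≤
      2 + X + 4 * J + 5 * X * ∑' j : ℕ, (j : ℝ) ^ (-(4 : ℝ) / 3) := by
  set S := ∑' j : ℕ, (j : ℝ) ^ (-(4 : ℝ) / 3) with hS
  have hN0 : (0 : ℝ) < N := by exact_mod_cast hN
  set q := (N : ℝ) ^ (-(1 : ℝ) / 3) / 2 with hq
  have hq0 : 0 ≤ q := by positivity
  have hq1 : q ≤ 1 / 2 := by
    have : (N : ℝ) ^ (-(1 : ℝ) / 3) ≤ 1 :=
      Real.rpow_le_one_of_one_le_of_nonpos (by exact_mod_cast hN) (by norm_num)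
    rw [hq]
    linarith
  have hqN : q * (2 * (N : ℝ) ^ ((2 : ℝ) / 3)) = (N : ℝ) ^ ((1 : ℝ) / 3) := by
    rw [hq, show (N : ℝ) ^ (-(1 : ℝ) / 3) / 2 * (2 * (N : ℝ) ^ ((2 : ℝ) / 3)) =
      (N : ℝ) ^ (-(1 : ℝ) / 3) * (N : ℝ) ^ ((2 : ℝ) / 3) by ring, ← Real.rpow_add hN0]
    norm_num
  set a : ℕ → ℝ := fun j => (N : ℝ) ^ ((2 : ℝ) / 3) * (γ j + 2) with ha
  have hya : ∀ j, K + 1 ≤ j → j ≤ N → |y j + 2 * (N : ℝ) ^ ((2 : ℝ) / 3) - a j| ≤ X := by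
    intro j hj hjN
    convert hyγ j hj hjN using 2
    simp only [ha]
    ring
  set r := ((K : ℝ) + 1) ^ ((2 : ℝ) / 3) with hr
  have hr0 : 0 ≤ r := by positivity
  have hrK : r ≤ K + 1 := by
    have : ((K : ℝ) + 1) ^ ((2 : ℝ) / 3) ≤ ((K : ℝ) + 1) ^ (1 : ℝ) :=
      Real.rpow_le_rpow_of_exponent_le (by linarith [(Nat.cast_nonneg K : (0 : ℝ) ≤ K)])
        (by norm_num)
    rwa [Real.rpow_one] at this
  have hY := abs_le.1 (hya (K + 1) le_rfl hKN.le)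
  have haK : a (K + 1) ≤ 16 * r := by
    have := scaled_quantile_le hγ (show 1 ≤ K + 1 by omega) hKN
    push_cast at this
    exact this
  have haK0 : 0 ≤ a (K + 1) := by
    have := neg_two_lt_quantile hγ (show 1 ≤ K + 1 by omega) hKN.le
    have : 0 ≤ γ (K + 1) + 2 := by linarith
    simp only [ha]
    positivity
  have hqY : |q * y (K + 1) + (N : ℝ) ^ ((1 : ℝ) / 3)  - q * a (K + 1)| ≤ X := by
    rw [← hqN, show q * y (K + 1) + q * (2 * (N : ℝ) ^ ((2 : ℝ) / 3)) - q * a (K + 1) =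
      q * (y (K + 1) + 2 * (N : ℝ) ^ ((2 : ℝ) / 3) - a (K + 1)) by ring, abs_mul, abs_of_nonneg hq0]
    have := hya (K + 1) le_rfl hKN.le
    nlinarith
  have hqY' := abs_le.1 hqY
  have hjr : ∀ j ∈ Finset.Ico J N, 2 * (16 * r + 2 * X) ≤ a j ∧
      1 / a j ^ 2 ≤ (j : ℝ) ^ (-(4 : ℝ) / 3) := by
    intro j hj
    rw [Finset.mem_Ico] at hj
    have hj0 : (0 : ℝ) < j := by exact_mod_cast (show 0 < j by omega)
    have h1 : (j : ℝ) ^ ((2 : ℝ) / 3) ≤ a j := rpow_le_scaled_quantile hγ (by omega) hj.2.le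
    have hjJ : (J : ℝ) ≤ j := by exact_mod_cast hj.1
    refine ⟨(thirtytwo_mul_add_le_rpow (by positivity) hX (hJ.trans hjJ)).trans h1, ?_⟩
    have h2 : (j : ℝ) ^ (-(4 : ℝ) / 3) = 1 / ((j : ℝ) ^ ((2 : ℝ) / 3)) ^ 2 := by
      rw [← Real.rpow_natCast, ← Real.rpow_mul hj0.le, one_div, ← Real.rpow_neg hj0.le]
      norm_num
    rw [h2]
    gcongr
  have hrange : ∀ j ∈ Finset.Ico J N, K + 1 ≤ j ∧ j ≤ N := fun j hj => by
    rw [Finset.mem_Ico] at hj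
    omega
  have hsum2 : ∑ j ∈ Finset.Ico J N, 1 / a j ^ 2 ≤ S :=
    (Finset.sum_le_sum fun j hj => (hjr j hj).2).trans (sum_rpow_neg_four_thirds_le _)
  have hb0 : 0 < 16 * r + 2 * X := by linarith
  constructor
  · have h1 : ∑ j ∈ Finset.Ico J N, 1 / (0 + (y j - y (K + 1))) ≤
        (N : ℝ) ^ ((1 : ℝ) / 3) + 2 * (16 * r + 2 * X) * S := by
      calc _ ≤ ∑ j ∈ Finset.Ico J N, (1 / a j + 2 * (16 * r + 2 * X) * (1 / a j ^ 2)) := by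
            refine Finset.sum_le_sum fun j hj => ?_
            have h2 := abs_le.1 (hya j (hrange j hj).1 (hrange j hj).2)
            have h3 := (hjr j hj).1
            have h4 : a j - (16 * r + 2 * X) ≤ 0 + (y j - y (K + 1)) := by linarith
            have h5 : 0 < a j - (16 * r + 2 * X) := by linarith
            have h6 : 0 < a j := by linarith
            refine (one_div_le_one_div_of_le h5 h4).trans ?_
            have h7 : 1 / a j + 2 * (16 * r + 2 * X) * (1 / a j ^ 2) =
                (a j + 2 * (16 * r + 2 * X)) / a j ^ 2 := by
              field_simp
            rw [h7, div_le_div_iff₀ h5 (by positivity)]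
            nlinarith [mul_nonneg hb0.le (sub_nonneg.2 h3)]
        _ ≤ _ := by
            rw [Finset.sum_add_distrib, ← Finset.mul_sum]
            gcongr
            exact sum_one_div_scaled_quantile_le hγ (by omega)
    have hS0 : 0 ≤ S := tsum_nonneg fun j => by positivity
    have h2 : (16 * r + 2 * X) * S ≤ (16 * ((K : ℝ) + 1) + 2 * X) * S := by gcongr
    have h3 : q * a (K + 1) ≤ 16 * r := by nlinarith
    unfold netForce
    linarith
  · have h1 : (N : ℝ) ^ ((1 : ℝ) / 3) - 4 * J - 5 * X * S ≤
        ∑ j ∈ Finset.Ico J N, 1 / (3 + (y j - y (K + 1))) := by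
      calc _ ≤ ∑ j ∈ Finset.Ico J N, 1 / a j - 5 * X * ∑ j ∈ Finset.Ico J N, 1 / a j ^ 2 := by
            have := le_sum_one_div_scaled_quantile hγ (show 1 ≤ J by omega)
            gcongr
        _ = ∑ j ∈ Finset.Ico J N, (1 / a j - 5 * X * (1 / a j ^ 2)) := by
            rw [Finset.sum_sub_distrib, ← Finset.mul_sum]
        _ ≤ _ := by
            refine Finset.sum_le_sum fun j hj => ?_
            have h2 := abs_le.1 (hya j (hrange j hj).1 (hrange j hj).2)
            have h3 := (hjr j hj).1
            have h4 : 3 + (y j - y (K + 1)) ≤ a j + 5 * X := by linarith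
            have h6 : 0 < a j := by linarith
            have h5 : 0 < 3 + (y j - y (K + 1)) := by linarith
            refine le_trans ?_ (one_div_le_one_div_of_le h5 h4)
            have h7 : 1 / a j - 5 * X * (1 / a j ^ 2) = (a j - 5 * X) / a j ^ 2 := by
              field_simp
            rw [h7, div_le_div_iff₀ (by positivity) (by positivity)]
            nlinarith
    have h3 : 0 ≤ q * a (K + 1) := by positivity
    rw [netForce, mul_sub]
    linarith only [h1, h3, hq1, hqY'.1]

end Rigidity

section Gap

variable {β : ℝ} {N K : ℕ} {γ y : ℕ → ℝ} {X t : ℝ} {P : Measure (Fin K → ℝ)} {Z : ℝ≥0∞}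

lemma gap_le_of_succ_lt (hβ : 1 ≤ β) (hK : 1 ≤ K) (hKN : K + 1 < N)
    (hγ : ∀ k : ℕ, 1 ≤ k → k ≤ N → (k : ℝ) / N = semicircleCDF (γ k)) (hX : 1 ≤ X)
    (hy : ∀ j k : ℕ, K + 1 ≤ j → j < k → k ≤ N → y j < y k)
    (hyγ : ∀ k : ℕ, K + 1 ≤ k → k ≤ N → |y k - (N : ℝ) ^ ((2 : ℝ) / 3) * γ k| ≤ X)
    [IsProbabilityMeasure P]
    (hP : P = Z⁻¹ • (volume.withDensity fun x => ENNReal.ofReal (condDensity β N K y x)))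
    (ht : 0 < t) (ht1 : t ≤ 1) (k : Fin K) :
    P {x | y (K + 1) - x k ≤ t} ≤ ENNReal.ofReal
      (β * t * K * (10000 * (1 + ∑' j : ℕ, (j : ℝ) ^ (-(4 : ℝ) / 3)) * (K + X ^ 2))) := by
  have hN : 0 < N := by omega
  have hK1 : (1 : ℝ) ≤ K := by exact_mod_cast hK
  have hXsq : X ≤ X ^ 2 := by nlinarith
  set J := ⌈512 * ((K : ℝ) + 1) + 64 * X ^ 2⌉₊ with hJ
  have hJ1 : 512 * ((K : ℝ) + 1) + 64 * X ^ 2 ≤ J := Nat.le_ceil _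
  have hJ2 : (J : ℝ) < 512 * ((K : ℝ) + 1) + 64 * X ^ 2 + 1 := Nat.ceil_lt_add_one (by positivity)
  have hJK : K + 2 ≤ J := by
    have : ((K + 2 : ℕ) : ℝ) ≤ J := by
      push_cast
      nlinarith
    exact_mod_cast this
  obtain ⟨hA', hB⟩ := netForce_bounds hN hKN hγ hX hyγ hJ1 hJK
  set S := ∑' j : ℕ, (j : ℝ) ^ (-(4 : ℝ) / 3) with hS
  have hS0 : 0 ≤ S := tsum_nonneg fun j => by positivity
  set A := (16 * ((K : ℝ) + 1) + 2 * X) * (1 + 2 * S) with hA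
  set B := 2 + X + 4 * J + 5 * X * S with hBdef
  have hA0 : 0 ≤ A := by positivity
  have hB0 : 0 ≤ B := by positivity
  have hN0 : (0 : ℝ) < N := by exact_mod_cast hN
  obtain ⟨u₀, ω, hu₀, hω, hω'⟩ := exists_weight_of_netForce (by positivity)
    (fun j hj => by
      rw [Finset.mem_Ico] at hj
      exact sub_pos.2 (hy (K + 1) j le_rfl (by omega) hj.2.le)) hA0 hA' hB
  have hd : ∀ j ∈ Finset.Ico J N, 0 < y j - y (K + 1) := fun j hj => by
    rw [Finset.mem_Ico] at hj
    exact sub_pos.2 (hy (K + 1) j le_rfl (by omega) hj.2.le)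
  have hmain := condDensity_gap_le (c := y (K + 1)) (ω := fun x => ω ((y (K + 1) - x) / 2))
    (c₀ := |B| + 3 * A) (A := A) (D := J) hβ hN hK le_rfl hA0 (by positivity) (by positivity) ht hu₀
    (fun x hx => (Vy_shift_le hN (by omega) hy ht ht1 hx).trans
      (mul_le_mul_of_nonneg_left (hω' _ (by linarith)) ht.le))
    (fun x hx => by
      have h := Vy_contraction_ge hN (show K + 1 ≤ J by omega) hy hx
      rw [← hω _ (by linarith)] at h
      exact h) hP k
  refine hmain.trans (ENNReal.ofReal_le_ofReal ?_)
  gcongr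
  rw [abs_of_nonneg hB0, hA, hBdef]
  have h1 : X * S ≤ X ^ 2 * S := by gcongr
  have h2 : 1 * S ≤ K * S := by gcongr
  linarith only [h1, h2, hJ2, hXsq, hX, hK1, mul_nonneg hS0 (sq_nonneg X),
    mul_nonneg hS0 (show (0 : ℝ) ≤ K by positivity), hS0]

lemma gap_le_of_succ_eq (hβ : 1 ≤ β) (hK : 1 ≤ K) (hKN : K + 1 = N) (hY : 0 ≤ y (K + 1))
    [IsProbabilityMeasure P]
    (hP : P = Z⁻¹ • (volume.withDensity fun x => ENNReal.ofReal (condDensity β N K y x)))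
    (ht : 0 < t) (ht1 : t ≤ 1) (k : Fin K) :
    P {x | y (K + 1) - x k ≤ t} ≤ ENNReal.ofReal (β * t * K * (17 * K)) := by
  have hN : 0 < N := by omega
  have hK1 : (1 : ℝ) ≤ K := by exact_mod_cast hK
  set q := (N : ℝ) ^ (-(1 : ℝ) / 3) / 2 with hq
  have hq0 : 0 ≤ q := by positivity
  have hq1 : q ≤ 1 / 2 := by
    have : (N : ℝ) ^ (-(1 : ℝ) / 3) ≤ 1 :=
      Real.rpow_le_one_of_one_le_of_nonpos (by exact_mod_cast hN) (by norm_num)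
    rw [hq]
    linarith
  have hV : ∀ x, x < y (K + 1) → (N : ℝ) / 2 * Vy N K y x =
      q * x ^ 2 / 2 - Real.log (y (K + 1) - x) := by
    intro x hx
    rw [half_mul_Vy hN, hKN, Finset.Icc_self, Finset.sum_singleton, abs_sub_comm, ← hKN,
      abs_of_pos (by linarith), hq, ← hKN]
  have hmain := condDensity_gap_le (c := 0) (ω := fun x => 3 / 8 * q * x ^ 2)
    (c₀ := 1) (A := 0) (D := 1) (u₀ := 1) hβ hN hK hY le_rfl zero_le_one zero_le_one ht le_rfl
    (fun x hx => by
      rw [hV x hx, hV (x - t) (by linarith)]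
      have h1 : Real.log (y (K + 1) - x) ≤ Real.log (y (K + 1) - (x - t)) :=
        Real.log_le_log (by linarith) (by linarith)
      have h2 : q * (t / 2 - x) ≤ 1 + 4 * (3 / 8 * q * x ^ 2) := by
        have h3 : t / 2 - x - 3 / 2 * x ^ 2 ≤ 1 := by nlinarith [sq_nonneg (x + 1 / 3)]
        nlinarith
      have h4 := mul_le_mul_of_nonneg_left h2 ht.le
      linarith)
    (fun x hx => by
      rw [hV x hx, hV ((x + 0) / 2) (by linarith)]
      have h1 : Real.log ((y (K + 1) - x) / 2) ≤ Real.log (y (K + 1) - (x + 0) / 2) :=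
        Real.log_le_log (by linarith) (by linarith)
      rw [Real.log_div (by linarith) (by norm_num)] at h1
      have h2 := Real.log_two_lt_d9
      linarith) hP k
  refine hmain.trans (ENNReal.ofReal_le_ofReal ?_)
  gcongr
  linarith

end Gap

/-- Weak gap bound for the conditioned measure `μ_y` with good boundary data `y ∈ R_K(ξ)`. -/
theorem cond_weak_gap_bound (β : ℝ) (hβ : 1 ≤ β) :
    ∃ C ξ₀ : ℝ, 0 < C ∧ 0 < ξ₀ ∧
      ∀ ξ : ℝ, 0 < ξ → ξ ≤ ξ₀ →
      ∀ N : ℕ, 2 ≤ N →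
      ∀ K : ℕ, ∀ hK : 1 ≤ K, (K : ℝ) ≤ (N : ℝ) ^ ((1 : ℝ) / 2) →
      ∀ γ : ℕ → ℝ,
        (∀ k : ℕ, 1 ≤ k → k ≤ N → (k : ℝ) / N = ∫ E in (-2 : ℝ)..(γ k), semicircle E) →
      ∀ y : ℕ → ℝ,
        (∀ j k : ℕ, K + 1 ≤ j → j < k → k ≤ N → y j < y k) →
        (∀ k : ℕ, K + 1 ≤ k → k ≤ N →
          |y k - (N : ℝ) ^ ((2 : ℝ) / 3) * γ k| ≤
            (N : ℝ) ^ ξ * ((min k (N + 1 - k) : ℕ) : ℝ) ^ (-(1 : ℝ) / 3)) →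
      ∀ P : Measure (Fin K → ℝ), IsProbabilityMeasure P →
      (∃ Z : ℝ≥0∞, Z ≠ 0 ∧ Z ≠ ⊤ ∧
        P = Z⁻¹ • (volume.withDensity fun x => ENNReal.ofReal (condDensity β N K y x))) →
      ∀ s : ℝ, 0 < s →
      P {x | y (K + 1) - x ⟨K - 1, by omega⟩ ≤ s * (K : ℝ) ^ (-(1 : ℝ) / 3)} ≤
        ENNReal.ofReal (C * s *
          ((K : ℝ) ^ 2 + (K : ℝ) * (N : ℝ) ^ (C * ξ))) := by
  set S := ∑' j : ℕ, (j : ℝ) ^ (-(4 : ℝ) / 3)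
  have hS0 : 0 ≤ S := tsum_nonneg fun j => by positivity
  have hC : 10000 * β ≤ β * (10000 * (1 + S)) := by
    nlinarith [mul_nonneg (zero_le_one.trans hβ) hS0]
  refine ⟨β * (10000 * (1 + S)), 1 / 2, by positivity, by norm_num, ?_⟩
  rintro ξ hξ hξ' N hN K hK hKN γ hγ y hy hyγ P _ ⟨Z, -, -, hP⟩ s hs
  have hN1 : (1 : ℝ) < N := by exact_mod_cast hN
  have hK1 : (1 : ℝ) ≤ K := by exact_mod_cast hK
  have hX : 1 ≤ (N : ℝ) ^ ξ := Real.one_le_rpow hN1.le hξ.le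
  have hXC : ((N : ℝ) ^ ξ) ^ 2 ≤ (N : ℝ) ^ (β * (10000 * (1 + S)) * ξ) := by
    rw [← Real.rpow_natCast, ← Real.rpow_mul (by positivity)]
    refine Real.rpow_le_rpow_of_exponent_le hN1.le ?_
    push_cast
    nlinarith
  have hKltN : K + 1 ≤ N := by
    have h1 : (N : ℝ) ^ ((1 : ℝ) / 2) < (N : ℝ) ^ (1 : ℝ) :=
      Real.rpow_lt_rpow_of_exponent_lt hN1 (by norm_num)
    rw [Real.rpow_one] at h1
    exact_mod_cast hKN.trans_lt h1
  have hyX : ∀ k : ℕ, K + 1 ≤ k → k ≤ N →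
      |y k - (N : ℝ) ^ ((2 : ℝ) / 3) * γ k| ≤ (N : ℝ) ^ ξ := fun k hk hkN =>
    (hyγ k hk hkN).trans (mul_le_of_le_one_right (by positivity)
      (Real.rpow_le_one_of_one_le_of_nonpos
        (by exact_mod_cast (show 1 ≤ min k (N + 1 - k) by omega)) (by norm_num)))
  have ht : 0 < s * (K : ℝ) ^ (-(1 : ℝ) / 3) := by positivity
  have hts : s * (K : ℝ) ^ (-(1 : ℝ) / 3) ≤ s := mul_le_of_le_one_right hs.le
    (Real.rpow_le_one_of_one_le_of_nonpos hK1 (by norm_num))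
  rcases lt_or_ge 1 (s * (K : ℝ) ^ (-(1 : ℝ) / 3)) with ht1 | ht1
  · refine prob_le_one.trans (ENNReal.one_le_ofReal.2 ?_)
    have h1 : 1 ≤ β * (10000 * (1 + S)) * s := by nlinarith
    have h2 : 1 ≤ (K : ℝ) ^ 2 + (K : ℝ) * (N : ℝ) ^ (β * (10000 * (1 + S)) * ξ) := by
      have : 0 ≤ (K : ℝ) * (N : ℝ) ^ (β * (10000 * (1 + S)) * ξ) := by positivity
      nlinarith
    exact one_le_mul_of_one_le_of_one_le h1 h2
  rcases hKltN.lt_or_eq with hlt | heq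
  · refine (gap_le_of_succ_lt hβ hK hlt hγ hX hy hyX hP ht ht1 _).trans
      (ENNReal.ofReal_le_ofReal ?_)
    calc _ ≤ β * s * K * (10000 * (1 + S) *
          (K + (N : ℝ) ^ (β * (10000 * (1 + S)) * ξ))) := by gcongr
      _ = _ := by ring
  · have hY : 0 ≤ y (K + 1) := by
      have h1 := abs_le.1 (hyX (K + 1) le_rfl heq.le)
      have h2 : (N : ℝ) ^ ξ ≤ (N : ℝ) ^ ((2 : ℝ) / 3) :=
        Real.rpow_le_rpow_of_exponent_le hN1.le (by linarith)
      have h3 : 2 ≤ γ (K + 1) := heq ▸ two_le_quantile_self (by omega) hγ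
      nlinarith
    refine (gap_le_of_succ_eq hβ hK heq hY hP ht ht1 _).trans (ENNReal.ofReal_le_ofReal ?_)
    calc _ ≤ β * s * K * (17 * K) := by gcongr
      _ = (17 * β) * s * (K : ℝ) ^ 2 := by ring
      _ ≤ _ := mul_le_mul (mul_le_mul_of_nonneg_right (by linarith) hs.le)
          (le_add_of_nonneg_right (by positivity)) (by positivity) (by positivity)
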